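/- The cumulative capacity-transition function q fails to be subadditive, so the stochastic SAIRP violates the sufficient conditions for the optimality of a monotone policy in the capacity dimension. Precisely: suppose s̃² < s² < 1, ã² < a² < M, and M > 0, and set j_A = g(s², a²), j_B = g(s̃², a²), j_C = g(s², ã²), j_D = g(s̃², ã²). Then max(j_B, j_C) < j_A, and for every k with max(j_B, j_C) < k ≤ j_A the subadditivity inequality fails: q(k | s², a²) + q(k | s̃², ã²) = 1 > 0 = q(k | s̃², a²) + q(k | s², ã²). -/

import Mathlib

/-- The unrounded average-capacity transition:
`g M δC a⁺ a⁻ s² a² = (1/M)·(s²·(M − a²) + a² − δC·(a⁺ + a⁻))`. -/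
noncomputable def capTransition (M δC ap am s2 a2 : ℝ) : ℝ :=
  (1 / M) * (s2 * (M - a2) + a2 - δC * (ap + am))

/-- The deterministic cumulative transition probability for the capacity
dimension: `q(k | s², a²) = 1` if `g(s², a²) ≥ k` and `0` otherwise. -/
noncomputable def cumProb (M δC ap am k s2 a2 : ℝ) : ℝ :=
  if capTransition M δC ap am s2 a2 ≥ k then 1 else 0

/-- The average-capacity transition is strictly increasing in the capacity as long as
some battery is not replaced. -/
theorem capTransition_lt_of_capacity_lt {M a2 s2 s2' : ℝ} (δC ap am : ℝ)
    (hM : 0 < M) (ha : a2 < M) (hs : s2' < s2) :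
    capTransition M δC ap am s2' a2 < capTransition M δC ap am s2 a2 := by
  unfold capTransition
  have := sub_pos.2 ha
  gcongr

/-- The average-capacity transition is strictly increasing in the replacement count
below full capacity. -/
theorem capTransition_lt_of_replacement_lt {M s2 a2 a2' : ℝ} (δC ap am : ℝ)
    (hM : 0 < M) (hs : s2 < 1) (ha : a2' < a2) :
    capTransition M δC ap am s2 a2' < capTransition M δC ap am s2 a2 := by
  unfold capTransition
  refine mul_lt_mul_of_pos_left ?_ (by positivity)
  linarith [mul_pos (sub_pos.2 hs) (sub_pos.2 ha)]

/-- the cumulative capacity-transition function fails to be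
subadditive: `max(j_B, j_C) < j_A`, and for `max(j_B, j_C) < k ≤ j_A`,
`q(k | s², a²) + q(k | s̃², ã²) = 1 > 0 = q(k | s̃², a²) + q(k | s², ã²)`. -/
theorem cumProb_not_subadditive
    (M δC ap am s2 s2' a2 a2' : ℝ)
    (hM : 0 < M) (hδ : 0 ≤ δC) (hap : 0 ≤ ap) (ham : 0 ≤ am)
    (hs' : s2' < s2) (hs1 : s2 < 1) (ha' : a2' < a2) (haM : a2 < M) :
    max (capTransition M δC ap am s2' a2) (capTransition M δC ap am s2 a2') <
      capTransition M δC ap am s2 a2 ∧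
    ∀ k : ℝ,
      max (capTransition M δC ap am s2' a2) (capTransition M δC ap am s2 a2') < k →
      k ≤ capTransition M δC ap am s2 a2 →
      (cumProb M δC ap am k s2 a2 + cumProb M δC ap am k s2' a2' = 1 ∧
       cumProb M δC ap am k s2' a2 + cumProb M δC ap am k s2 a2' = 0 ∧
       cumProb M δC ap am k s2 a2 + cumProb M δC ap am k s2' a2' >
         cumProb M δC ap am k s2' a2 + cumProb M δC ap am k s2 a2') := by
  have hBA := capTransition_lt_of_capacity_lt δC ap am hM haM hs'
  have hCA := capTransition_lt_of_replacement_lt δC ap am hM hs1 ha'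
  have hDB := capTransition_lt_of_replacement_lt δC ap am hM (hs'.trans hs1) ha'
  refine ⟨max_lt hBA hCA, fun k hk hkA => ?_⟩
  obtain ⟨hBk, hCk⟩ := max_lt_iff.1 hk
  have hDk := hDB.trans hBk
  simp [cumProb, hkA, hBk.not_ge, hCk.not_ge, hDk.not_ge]
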